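/- arXiv:1308.4943 — 2 statements merged into one kernel-verified Lean document; each statement's English description precedes it below -/
import Mathlib

section
/- If ⟨A1,L1⟩ and ⟨A2,L2⟩ are arguments with A1 ⊆ A2 and L1 = L2, then ⟨A1,L1⟩ ≲P3 ⟨A2,L2⟩. -/
/-- A literal: an atom, possibly prefixed with negation. -/
inductive Lit (α : Type) : Type where
  | pos : α → Lit α
  | neg : α → Lit α
  deriving DecidableEq

/-- A (ground) rule: a head literal together with a finite (possibly empty)
conjunction of body literals.  A rule with empty body is just a literal. -/
structure Rule (α : Type) : Type where
  head : Lit α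
  body : Finset (Lit α)
  deriving DecidableEq

/-- View a set of literals as a set of bodiless rules. -/
def litRules {α : Type} (S : Set (Lit α)) : Set (Rule α) :=
  {r | r.head ∈ S ∧ r.body = ∅}

/-- The theory `𝔗_P` of a set of rules `P`: the least set of literals
containing the bodiless rules of `P` and closed under the rules of `P`. -/
inductive Th {α : Type} (P : Set (Rule α)) : Lit α → Prop where
  | step (r : Rule α) (hr : r ∈ P) (ih : ∀ l ∈ r.body, Th P l) : Th P r.head

/-- A set of rules is contradictory iff it derives both `A` and `¬A`
for some atom `A`. -/
def Contradictory {α : Type} (P : Set (Rule α)) : Prop :=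
  ∃ a : α, Th P (Lit.pos a) ∧ Th P (Lit.neg a)

/-- A defeasible specification `⟨Π^F, Π^G, Δ⟩`:
facts, general (strict) rules, and defeasible rules (all taken ground). -/
structure Spec (α : Type) : Type where
  F : Set (Lit α)
  G : Set (Rule α)
  D : Set (Rule α)

namespace Spec

variable {α : Type}

/-- `Π := Π^F ∪ Π^G`. -/
def strict (S : Spec α) : Set (Rule α) := litRules S.F ∪ S.G

/-- `𝔗_Π`. -/
def ThStrict (S : Spec α) : Set (Lit α) := {l | Th S.strict l}

/-- `𝔗_{Π ∪ Δ}`. -/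
def ThAll (S : Spec α) : Set (Lit α) := {l | Th (S.strict ∪ S.D) l}

/-- `⟨A, L⟩` is an argument: `A` is a set of (ground instances of) defeasible
rules from `Δ` and `A ∪ Π` derives `L`. -/
def IsArgument (S : Spec α) (A : Set (Rule α)) (L : Lit α) : Prop :=
  A ⊆ S.D ∧ Th (A ∪ S.strict) L

/-- `H` is a simplified activation set for `⟨A, L⟩`:  `L ∈ 𝔗_{H ∪ A ∪ Π^G}`. -/
def SAct (S : Spec α) (A : Set (Rule α)) (L : Lit α) (H : Set (Lit α)) : Prop :=
  Th (litRules H ∪ A ∪ S.G) L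

/-- `H` is an activation set for `⟨A, L⟩`:
`L ∈ 𝔗_{𝔏 ∪ Π}` for some `𝔏 ⊆ 𝔗_{H ∪ A ∪ Π^G}`. -/
def Act (S : Spec α) (A : Set (Rule α)) (L : Lit α) (H : Set (Lit α)) : Prop :=
  ∃ Ls : Set (Lit α), Ls ⊆ {l | Th (litRules H ∪ A ∪ S.G) l} ∧
    Th (litRules Ls ∪ S.strict) L

/-- `H` is a minimal simplified activation set for `⟨A, L⟩`. -/
def MinSAct (S : Spec α) (A : Set (Rule α)) (L : Lit α) (H : Set (Lit α)) : Prop :=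
  S.SAct A L H ∧ ∀ H' ⊂ H, ¬ S.SAct A L H'

/-- `H` is a minimal activation set for `⟨A, L⟩`. -/
def MinAct (S : Spec α) (A : Set (Rule α)) (L : Lit α) (H : Set (Lit α)) : Prop :=
  S.Act A L H ∧ ∀ H' ⊂ H, ¬ S.Act A L H'

/-- Poole's original specificity relation `≲P1`. -/
def leP1 (S : Spec α) (X Y : Set (Rule α) × Lit α) : Prop :=
  S.IsArgument X.1 X.2 ∧ S.IsArgument Y.1 Y.2 ∧
    ∀ H ⊆ S.ThAll, S.SAct X.1 X.2 H → ¬ S.SAct Y.1 X.2 H → S.SAct Y.1 Y.2 H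

/-- The standard version `≲P2` of Poole's specificity. -/
def leP2 (S : Spec α) (X Y : Set (Rule α) × Lit α) : Prop :=
  S.IsArgument X.1 X.2 ∧ S.IsArgument Y.1 Y.2 ∧
    ∀ H ⊆ S.ThAll, S.SAct X.1 X.2 H → ¬ S.SAct ∅ X.2 H → S.SAct Y.1 Y.2 H

/-- The rather unflawed version `≲P3` of Poole's specificity. -/
def leP3 (S : Spec α) (X Y : Set (Rule α) × Lit α) : Prop :=
  S.IsArgument X.1 X.2 ∧ S.IsArgument Y.1 Y.2 ∧
    (Y.2 ∈ S.ThStrict → X.2 ∈ S.ThStrict) ∧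
    ∀ H ⊆ S.ThAll, S.SAct X.1 X.2 H → ¬ S.SAct ∅ X.2 H → S.SAct Y.1 Y.2 H

/-- The corrected specificity relation `≲CP`. -/
def leCP (S : Spec α) (X Y : Set (Rule α) × Lit α) : Prop :=
  S.IsArgument X.1 X.2 ∧ S.IsArgument Y.1 Y.2 ∧
    (X.2 ∈ S.ThStrict ∨
      (Y.2 ∉ S.ThStrict ∧
        ∀ H ⊆ S.ThStrict, S.Act X.1 X.2 H → S.Act Y.1 Y.2 H))

/-- `<P1 := ≲P1 \ ≳P1`. -/
def ltP1 (S : Spec α) (X Y : Set (Rule α) × Lit α) : Prop := S.leP1 X Y ∧ ¬ S.leP1 Y X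
/-- `<P2 := ≲P2 \ ≳P2`. -/
def ltP2 (S : Spec α) (X Y : Set (Rule α) × Lit α) : Prop := S.leP2 X Y ∧ ¬ S.leP2 Y X
/-- `<P3 := ≲P3 \ ≳P3`. -/
def ltP3 (S : Spec α) (X Y : Set (Rule α) × Lit α) : Prop := S.leP3 X Y ∧ ¬ S.leP3 Y X
/-- `<CP := ≲CP \ ≳CP`. -/
def ltCP (S : Spec α) (X Y : Set (Rule α) × Lit α) : Prop := S.leCP X Y ∧ ¬ S.leCP Y X

/-- `Π^{<2}`: rules of `Π` with at most one body literal. -/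
def strictLt2 (S : Spec α) : Set (Rule α) := {r ∈ S.strict | r.body.card ≤ 1}

/-- `Π^{≥2}`: rules of `Π` with at least two body literals. -/
def strictGe2 (S : Spec α) : Set (Rule α) := {r ∈ S.strict | 2 ≤ r.body.card}

/-- Condition 1 of Theorem 16. -/
def Cond1 (S : Spec α) : Prop :=
  ∀ H ⊆ S.ThStrict, ∀ A ⊆ S.D,
    {l | Th (litRules {l | Th (litRules H ∪ A ∪ S.G) l} ∪ S.strict) l} ⊆
      {l | Th (litRules H ∪ A ∪ S.G) l} ∪ S.ThStrict

/-- Condition 2 of Theorem 16. -/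
def Cond2 (S : Spec α) : Prop :=
  ∀ r ∈ S.strictGe2, r.head ∉ {l | Th S.strictLt2 l} →
    ∀ l ∈ r.body, l ∉ {l | Th S.strictLt2 l}

/-- Condition 3 of Theorem 16. -/
def Cond3 (S : Spec α) : Prop :=
  ∀ r ∈ S.strictGe2, ∀ l ∈ r.body, l ∉ S.ThStrict

/-- Condition 4 of Theorem 16. -/
def Cond4 (S : Spec α) : Prop := S.strictGe2 = ∅

end Spec

theorem Th.mono {α : Type} {P Q : Set (Rule α)} (hPQ : P ⊆ Q) {L : Lit α} (h : Th P L) :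
    Th Q L := by
  induction h with
  | step r hr _ ih => exact Th.step r (hPQ hr) ih

theorem Spec.SAct.mono {α : Type} {S : Spec α} {A B : Set (Rule α)} (hAB : A ⊆ B) {L : Lit α}
    {H : Set (Lit α)} (h : S.SAct A L H) : S.SAct B L H :=
  Th.mono (Set.union_subset_union_left _ (Set.union_subset_union_right _ hAB)) h

/-- Corollary 13: sub-arguments are more (or equivalently) specific w.r.t. `≲P3`. -/
theorem leP3_of_subset {α : Type} (S : Spec α) (A1 A2 : Set (Rule α)) (L1 L2 : Lit α)
    (h1 : S.IsArgument A1 L1) (h2 : S.IsArgument A2 L2)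
    (hsub : A1 ⊆ A2) (heq : L1 = L2) :
    S.leP3 (A1, L1) (A2, L2) := by
  subst heq
  exact ⟨h1, h2, id, fun _ _ h _ => h.mono hsub⟩
end

section
/- For the specification of the first variation of Poole's Example 6, one has ⟨A1,g1⟩ <CP ⟨A2,g2⟩ (i.e. ⟨A1,g1⟩ ≲CP ⟨A2,g2⟩ and not ⟨A2,g2⟩ ≲CP ⟨A1,g1⟩), whereas under ≲P3 the two arguments are incomparable: neither ⟨A1,g1⟩ ≲P3 ⟨A2,g2⟩ nor ⟨A2,g2⟩ ≲P3 ⟨A1,g1⟩. -/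
/-- Atoms of Poole's Example 6. -/
inductive Atom6 : Type where
  | a | b | c | d | e | f | g1 | g2
  deriving DecidableEq

open Lit Atom6 in
/-- `A1 = {¬c ⤙ a, ¬f ⤙ d}`. -/
def ex6vA1 : Set (Rule Atom6) := {⟨neg c, {pos a}⟩, ⟨neg f, {pos d}⟩}

open Lit Atom6 in
/-- `A2 = {c ⤙ b, e ⤙ d, f ⤙ e}`. -/
def ex6vA2 : Set (Rule Atom6) :=
  {⟨pos c, {pos b}⟩, ⟨pos e, {pos d}⟩, ⟨pos f, {pos e}⟩}

open Lit Atom6 in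
/-- The specification of the first variation of Poole's Example 6. -/
def ex6v : Spec Atom6 where
  F := {pos a, pos d}
  G := {⟨pos g1, {neg c, neg f}⟩, ⟨pos g2, {pos c, pos f}⟩, ⟨pos b, {pos a}⟩}
  D := ex6vA1 ∪ ex6vA2

theorem Th.of_mem {α : Type} {P : Set (Rule α)} {l : Lit α} {B : Finset (Lit α)}
    (hr : (⟨l, B⟩ : Rule α) ∈ P) (ih : ∀ k ∈ B, Th P k) : Th P l :=
  Th.step ⟨l, B⟩ hr ih

theorem Th.mem_of_closed {α : Type} {P : Set (Rule α)} {M : Set (Lit α)}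
    (hM : ∀ r ∈ P, (∀ k ∈ r.body, k ∈ M) → r.head ∈ M) {l : Lit α} (h : Th P l) : l ∈ M := by
  induction h with
  | step r hr _ ih => exact hM r hr ih

section Example6

open Lit Atom6

theorem mem_ex6v_G {r : Rule Atom6} : r ∈ ex6v.G ↔
    r = ⟨pos g1, {neg c, neg f}⟩ ∨ r = ⟨pos g2, {pos c, pos f}⟩ ∨ r = ⟨pos b, {pos a}⟩ :=
  Iff.rfl

theorem mem_ex6vA1 {r : Rule Atom6} :
    r ∈ ex6vA1 ↔ r = ⟨neg c, {pos a}⟩ ∨ r = ⟨neg f, {pos d}⟩ :=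
  Iff.rfl

theorem mem_ex6vA2 {r : Rule Atom6} : r ∈ ex6vA2 ↔
    r = ⟨pos c, {pos b}⟩ ∨ r = ⟨pos e, {pos d}⟩ ∨ r = ⟨pos f, {pos e}⟩ :=
  Iff.rfl

theorem mem_ex6v_strict {r : Rule Atom6} : r ∈ ex6v.strict ↔
    ((r.head = pos a ∨ r.head = pos d) ∧ r.body = ∅) ∨ r ∈ ex6v.G :=
  Iff.rfl

theorem ex6v_ThStrict_subset : ex6v.ThStrict ⊆ {pos a, pos b, pos d} := by
  intro l hl
  refine Th.mem_of_closed ?_ hl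
  intro r hr
  rw [mem_ex6v_strict, mem_ex6v_G] at hr
  rcases hr with ⟨h | h, -⟩ | rfl | rfl | rfl <;> simp_all

theorem Th_ex6v_fact {P : Set (Rule Atom6)} (hP : ex6v.strict ⊆ P) :
    Th P (pos a) ∧ Th P (pos d) :=
  ⟨Th.of_mem (B := ∅) (hP (by simp [mem_ex6v_strict])) (by simp),
    Th.of_mem (B := ∅) (hP (by simp [mem_ex6v_strict])) (by simp)⟩

theorem Th_ex6v_b {P : Set (Rule Atom6)} (hG : ex6v.G ⊆ P) (ha : Th P (pos a)) :
    Th P (pos b) :=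
  Th.of_mem (hG (mem_ex6v_G.2 (.inr (.inr rfl)))) (by simpa using ha)

theorem Th_ex6v_negc {P : Set (Rule Atom6)} (hA : ex6vA1 ⊆ P) (ha : Th P (pos a)) :
    Th P (neg c) :=
  Th.of_mem (hA (mem_ex6vA1.2 (.inl rfl))) (by simpa using ha)

theorem Th_ex6v_negf {P : Set (Rule Atom6)} (hA : ex6vA1 ⊆ P) (hd : Th P (pos d)) :
    Th P (neg f) :=
  Th.of_mem (hA (mem_ex6vA1.2 (.inr rfl))) (by simpa using hd)

theorem Th_ex6v_g1 {P : Set (Rule Atom6)} (hG : ex6v.G ⊆ P)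
    (hc : Th P (neg c)) (hf : Th P (neg f)) : Th P (pos g1) :=
  Th.of_mem (hG (mem_ex6v_G.2 (.inl rfl))) (by simpa using ⟨hc, hf⟩)

theorem Th_ex6v_g2 {P : Set (Rule Atom6)} (hG : ex6v.G ⊆ P) (hA : ex6vA2 ⊆ P)
    (hb : Th P (pos b)) (hd : Th P (pos d)) : Th P (pos g2) := by
  have hc : Th P (pos c) := Th.of_mem (hA (mem_ex6vA2.2 (.inl rfl))) (by simpa using hb)
  have he : Th P (pos e) :=
    Th.of_mem (hA (mem_ex6vA2.2 (.inr (.inl rfl)))) (by simpa using hd)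
  have hf : Th P (pos f) :=
    Th.of_mem (hA (mem_ex6vA2.2 (.inr (.inr rfl)))) (by simpa using he)
  exact Th.of_mem (hG (mem_ex6v_G.2 (.inr (.inl rfl)))) (by simpa using ⟨hc, hf⟩)

theorem Th_of_mem_lits {P : Set (Rule Atom6)} {H : Set (Lit Atom6)} (hH : litRules H ⊆ P)
    {l : Lit Atom6} (hl : l ∈ H) : Th P l :=
  Th.of_mem (B := ∅) (hH ⟨hl, rfl⟩) (by simp)

theorem ex6v_Th_A1_subset {H : Set (Lit Atom6)} (hH : H ⊆ {pos a, pos b, pos d})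
    {l : Lit Atom6} (hl : Th (litRules H ∪ ex6vA1 ∪ ex6v.G) l) :
    l ∈ H ∨ l = pos b ∨ (l = neg c ∧ pos a ∈ H) ∨ (l = neg f ∧ pos d ∈ H) ∨
      (l = pos g1 ∧ pos a ∈ H ∧ pos d ∈ H) := by
  refine Th.mem_of_closed (M := {l | l ∈ H ∨ l = pos b ∨ (l = neg c ∧ pos a ∈ H) ∨
    (l = neg f ∧ pos d ∈ H) ∨ (l = pos g1 ∧ pos a ∈ H ∧ pos d ∈ H)}) ?_ hl
  have hc : pos c ∉ H := fun h => by simpa using hH h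
  have hnc : neg c ∉ H := fun h => by simpa using hH h
  have hnf : neg f ∉ H := fun h => by simpa using hH h
  rintro r ((⟨h, -⟩ | hr) | hr)
  · exact fun _ => .inl h
  · rcases mem_ex6vA1.1 hr with rfl | rfl <;> simp_all
  · rcases mem_ex6v_G.1 hr with rfl | rfl | rfl <;> simp_all

theorem ex6v_mem_of_act_A1 {H : Set (Lit Atom6)} (hH : H ⊆ {pos a, pos b, pos d})
    (h : ex6v.Act ex6vA1 (pos g1) H) : pos a ∈ H ∧ pos d ∈ H := by
  obtain ⟨Ls, hLs, h⟩ := h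
  have key := Th.mem_of_closed (M := {l | l ∈ ({pos a, pos b, pos d} : Set (Lit Atom6)) ∨
    (l = neg c ∧ pos a ∈ H) ∨ (l = neg f ∧ pos d ∈ H) ∨
      (l = pos g1 ∧ pos a ∈ H ∧ pos d ∈ H)}) ?_ h
  · simpa using key
  rintro r (⟨hr, -⟩ | hr)
  · intro _
    rcases ex6v_Th_A1_subset hH (hLs hr) with h | h | h | h | h
    · exact .inl (hH h)
    · simp [h]
    · exact .inr (.inl h)
    · exact .inr (.inr (.inl h))
    · exact .inr (.inr (.inr h))
  · rcases mem_ex6v_strict.1 hr with ⟨h | h, -⟩ | hr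
    · simp [h]
    · simp [h]
    · rcases mem_ex6v_G.1 hr with rfl | rfl | rfl <;> simp

theorem Spec.SAct.act {α : Type} {S : Spec α} {A : Set (Rule α)} {L : Lit α}
    {H : Set (Lit α)} (h : S.SAct A L H) : S.Act A L H :=
  ⟨{L}, Set.singleton_subset_iff.2 h, Th.of_mem (B := ∅) (.inl ⟨rfl, rfl⟩) (by simp)⟩

theorem ex6v_sAct_A2 {H : Set (Lit Atom6)}
    (hb : Th (litRules H ∪ ex6vA2 ∪ ex6v.G) (pos b)) (hd : pos d ∈ H) :
    ex6v.SAct ex6vA2 (pos g2) H :=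
  Th_ex6v_g2 Set.subset_union_right
    (Set.subset_union_right.trans Set.subset_union_left) hb
    (Th_of_mem_lits (Set.subset_union_left.trans Set.subset_union_left) hd)

theorem ex6v_sAct_A2_bd : ex6v.SAct ex6vA2 (pos g2) {pos b, pos d} :=
  ex6v_sAct_A2 (Th_of_mem_lits (Set.subset_union_left.trans Set.subset_union_left)
    (by simp)) (by simp)

theorem ex6v_not_act_A1_bd : ¬ ex6v.Act ex6vA1 (pos g1) {pos b, pos d} := fun h => by
  simpa using (ex6v_mem_of_act_A1 (by simp) h).1

theorem ex6v_not_sAct_empty_bd : ¬ ex6v.SAct ∅ (pos g2) {pos b, pos d} := fun h => by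
  have key := Th.mem_of_closed (M := {pos b, pos d}) ?_ h
  · simp at key
  rintro r ((⟨hr, -⟩ | hr) | hr)
  · exact fun _ => hr
  · exact hr.elim
  · rcases mem_ex6v_G.1 hr with rfl | rfl | rfl <;> simp

theorem ex6v_sAct_A1_a_negf : ex6v.SAct ex6vA1 (pos g1) {pos a, neg f} :=
  Th_ex6v_g1 Set.subset_union_right
    (Th_ex6v_negc (Set.subset_union_right.trans Set.subset_union_left)
      (Th_of_mem_lits (Set.subset_union_left.trans Set.subset_union_left) (by simp)))
    (Th_of_mem_lits (Set.subset_union_left.trans Set.subset_union_left) (by simp))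

theorem ex6v_not_sAct_empty_a_negf : ¬ ex6v.SAct ∅ (pos g1) {pos a, neg f} := fun h => by
  have key := Th.mem_of_closed (M := {pos a, pos b, neg f}) ?_ h
  · simp at key
  rintro r ((⟨hr, -⟩ | hr) | hr)
  · exact fun _ => by rcases hr with h | h <;> simp_all
  · exact hr.elim
  · rcases mem_ex6v_G.1 hr with rfl | rfl | rfl <;> simp

theorem ex6v_not_sAct_A2_a_negf : ¬ ex6v.SAct ex6vA2 (pos g2) {pos a, neg f} := fun h => by
  have key := Th.mem_of_closed (M := {pos a, pos b, pos c, neg f}) ?_ h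
  · simp at key
  rintro r ((⟨hr, -⟩ | hr) | hr)
  · exact fun _ => by rcases hr with h | h <;> simp_all
  · rcases mem_ex6vA2.1 hr with rfl | rfl | rfl <;> simp
  · rcases mem_ex6v_G.1 hr with rfl | rfl | rfl <;> simp

theorem ex6v_isArgument_A1 : ex6v.IsArgument ex6vA1 (pos g1) := by
  obtain ⟨ha, hd⟩ := Th_ex6v_fact (P := ex6vA1 ∪ ex6v.strict) Set.subset_union_right
  exact ⟨Set.subset_union_left,
    Th_ex6v_g1 (Set.subset_union_right.trans Set.subset_union_right)
      (Th_ex6v_negc Set.subset_union_left ha) (Th_ex6v_negf Set.subset_union_left hd)⟩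

theorem ex6v_isArgument_A2 : ex6v.IsArgument ex6vA2 (pos g2) := by
  obtain ⟨ha, hd⟩ := Th_ex6v_fact (P := ex6vA2 ∪ ex6v.strict) Set.subset_union_right
  have hG : ex6v.G ⊆ ex6vA2 ∪ ex6v.strict :=
    Set.subset_union_right.trans Set.subset_union_right
  exact ⟨Set.subset_union_right,
    Th_ex6v_g2 hG Set.subset_union_left (Th_ex6v_b hG ha) hd⟩

theorem ex6v_bd_subset {P : Set (Rule Atom6)} (hP : ex6v.strict ⊆ P) :
    {pos b, pos d} ⊆ {l | Th P l} := by
  obtain ⟨ha, hd⟩ := Th_ex6v_fact hP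
  rintro l (rfl | rfl)
  · exact Th_ex6v_b (Set.subset_union_right.trans hP) ha
  · exact hd

theorem ex6v_a_negf_subset : {pos a, neg f} ⊆ ex6v.ThAll := by
  obtain ⟨ha, hd⟩ := Th_ex6v_fact (P := ex6v.strict ∪ ex6v.D) Set.subset_union_left
  rintro l (rfl | rfl)
  · exact ha
  · exact Th_ex6v_negf (Set.subset_union_left.trans Set.subset_union_right) hd

theorem ex6v_act_A2_of_act_A1 {H : Set (Lit Atom6)} (hH : H ⊆ ex6v.ThStrict)
    (h : ex6v.Act ex6vA1 (pos g1) H) : ex6v.Act ex6vA2 (pos g2) H := by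
  obtain ⟨ha, hd⟩ := ex6v_mem_of_act_A1 (hH.trans ex6v_ThStrict_subset) h
  exact (ex6v_sAct_A2 (Th_ex6v_b Set.subset_union_right
    (Th_of_mem_lits (Set.subset_union_left.trans Set.subset_union_left) ha)) hd).act

end Example6

/-- First variation of Poole's Example 6: `⟨A1,g1⟩ <CP ⟨A2,g2⟩`, but the
two arguments are incomparable w.r.t. `≲P3`. -/
theorem example6_variation1 :
    ex6v.ltCP (ex6vA1, Lit.pos Atom6.g1) (ex6vA2, Lit.pos Atom6.g2) ∧
    ¬ ex6v.leP3 (ex6vA1, Lit.pos Atom6.g1) (ex6vA2, Lit.pos Atom6.g2) ∧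
    ¬ ex6v.leP3 (ex6vA2, Lit.pos Atom6.g2) (ex6vA1, Lit.pos Atom6.g1) := by
  refine ⟨⟨⟨ex6v_isArgument_A1, ex6v_isArgument_A2, .inr ⟨fun h => ?_, ?_⟩⟩, ?_⟩, ?_, ?_⟩
  · simpa using ex6v_ThStrict_subset h
  · exact fun H hH h => ex6v_act_A2_of_act_A1 hH h
  · rintro ⟨-, -, h | ⟨-, h⟩⟩
    · simpa using ex6v_ThStrict_subset h
    · exact ex6v_not_act_A1_bd (h _ (ex6v_bd_subset subset_rfl) ex6v_sAct_A2_bd.act)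
  · rintro ⟨-, -, -, h⟩
    exact ex6v_not_sAct_A2_a_negf
      (h _ ex6v_a_negf_subset ex6v_sAct_A1_a_negf ex6v_not_sAct_empty_a_negf)
  · rintro ⟨-, -, -, h⟩
    exact ex6v_not_act_A1_bd
      (h _ (ex6v_bd_subset Set.subset_union_left) ex6v_sAct_A2_bd ex6v_not_sAct_empty_bd).act
end
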